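/- arXiv:1904.02736 — 7 statements merged into one kernel-verified Lean document; each statement's English description precedes it below -/
import Mathlib

section
/- Hurewicz's Theorem: Let X be a topological space satisfying Menger's property S_fin(O,O). Then Alice does not have a winning strategy in the Menger game G_fin(O,O) played on X. -/
/-- `𝒰` is an open cover of the space `X`. -/
def IsOpenCover {X : Type*} [TopologicalSpace X] (𝒰 : Set (Set X)) : Prop :=
  (∀ U ∈ 𝒰, IsOpen U) ∧ ⋃₀ 𝒰 = Set.univ

/-- Menger's property `S_fin(O,O)`: for every sequence of open covers there are finite
subfamilies whose union covers the space. -/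
def MengerSpace (X : Type*) [TopologicalSpace X] : Prop :=
  ∀ 𝒰 : ℕ → Set (Set X), (∀ n, IsOpenCover (𝒰 n)) →
    ∃ ℱ : ℕ → Set (Set X), (∀ n, (ℱ n).Finite ∧ ℱ n ⊆ 𝒰 n) ∧
      ⋃₀ (⋃ n, ℱ n) = Set.univ

/-- A strategy for Alice in the Menger game `G_fin(O,O)` (a function from finite histories of
Bob's moves to covers) is winning if for every play of Bob consisting of legal moves
(finite subsets of Alice's covers), Bob's selections fail to cover the space. -/
def MengerWinningStrategy {X : Type*} [TopologicalSpace X]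
    (strat : List (Set (Set X)) → Set (Set X)) : Prop :=
  ∀ F : ℕ → Set (Set X),
    (∀ n, (F n).Finite ∧ F n ⊆ strat (List.ofFn fun i : Fin n => F i)) →
    ⋃₀ (⋃ n, F n) ≠ Set.univ

/-- In a Menger space every open cover has an increasing sequence of finite subfamilies that
together cover the space. -/
theorem MengerSpace.exists_monotone_finite {X : Type*} [TopologicalSpace X] (hX : MengerSpace X)
    {𝒰 : Set (Set X)} (h𝒰 : IsOpenCover 𝒰) :
    ∃ E : ℕ → Set (Set X), Monotone E ∧ (∀ m, (E m).Finite ∧ E m ⊆ 𝒰) ∧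
      ∀ x, ∃ m, x ∈ ⋃₀ E m := by
  obtain ⟨ℱ, hℱ, hcov⟩ := hX (fun _ => 𝒰) fun _ => h𝒰
  refine ⟨fun m => ⋃ k ∈ Set.Iic m, ℱ k, ?_, fun m => ⟨?_, ?_⟩, fun x => ?_⟩
  · exact fun a b hab => Set.biUnion_subset_biUnion_left (Set.Iic_subset_Iic.2 hab)
  · exact (Set.finite_Iic m).biUnion fun k _ => (hℱ k).1
  · exact Set.iUnion₂_subset fun k _ => (hℱ k).2
  · obtain ⟨V, hV, hxV⟩ : x ∈ ⋃₀ ⋃ n, ℱ n := hcov ▸ Set.mem_univ x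
    obtain ⟨n, hn⟩ := Set.mem_iUnion.1 hV
    exact ⟨n, V, Set.mem_biUnion (Set.mem_Iic.2 le_rfl) hn, hxV⟩

/-- In a tree of open sets that grow along branches and whose successor families are increasing
covers, every point has, at each level, a neighbourhood contained in all but finitely many of the
sets of that level. -/
theorem exists_isOpen_subset_of_tree {X : Type*} [TopologicalSpace X] {U : List ℕ → Set X}
    (hopen : ∀ σ, IsOpen (U σ)) (hcons : ∀ m σ, U σ ⊆ U (m :: σ))
    (hmono : ∀ σ, Monotone fun m => U (m :: σ)) (hcov : ∀ σ x, ∃ m, x ∈ U (m :: σ))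
    (n : ℕ) (x : X) :
    ∃ W : Set X, IsOpen W ∧ x ∈ W ∧
      ∃ S : Set (List ℕ), S.Finite ∧ ∀ σ, σ.length = n → σ ∉ S → W ⊆ U σ := by
  induction n with
  | zero =>
    refine ⟨Set.univ, isOpen_univ, Set.mem_univ x, {[]}, Set.finite_singleton _, ?_⟩
    intro σ hσ hσ'
    exact absurd (List.length_eq_zero_iff.1 hσ) hσ'
  | succ n ih =>
    obtain ⟨W, hW, hxW, S, hS, hWS⟩ := ih
    choose b hb using fun σ => hcov σ x
    refine ⟨W ∩ ⋂ σ ∈ S, U (b σ :: σ), hW.inter (hS.isOpen_biInter fun σ _ => hopen _),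
      ⟨hxW, Set.mem_iInter₂.2 fun σ _ => hb σ⟩,
      ⋃ σ ∈ S, (fun m => m :: σ) '' Set.Iio (b σ),
      hS.biUnion fun σ _ => (Set.finite_Iio _).image _, ?_⟩
    rintro (_ | ⟨m, σ⟩) hlen hnot
    · simp at hlen
    by_cases hσ : σ ∈ S
    · have hm : b σ ≤ m := by
        by_contra! hm
        exact hnot (Set.mem_biUnion hσ ⟨m, hm, rfl⟩)
      exact Set.inter_subset_right.trans
        ((Set.biInter_subset_of_mem hσ).trans (hmono σ hm))
    · exact Set.inter_subset_left.trans ((hWS σ (by simpa using hlen) hσ).trans (hcons m σ))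

/-- In a Menger space, a tree of open sets that grow along branches and whose successor families
are increasing covers has a branch that covers the space. -/
theorem MengerSpace.exists_branch_of_tree {X : Type*} [TopologicalSpace X] (hX : MengerSpace X)
    {U : List ℕ → Set X} (hopen : ∀ σ, IsOpen (U σ)) (hcons : ∀ m σ, U σ ⊆ U (m :: σ))
    (hmono : ∀ σ, Monotone fun m => U (m :: σ)) (hcov : ∀ σ x, ∃ m, x ∈ U (m :: σ)) :
    ∃ (p : ℕ → List ℕ) (m : ℕ → ℕ), p 0 = [] ∧ (∀ n, p (n + 1) = m n :: p n) ∧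
      ∀ x, ∃ n, x ∈ U (p n) := by
  obtain ⟨ℱ, hℱ, hℱcov⟩ := hX
    (fun n => {W | IsOpen W ∧ ∃ S : Set (List ℕ), S.Finite ∧
      ∀ σ, σ.length = n + 1 → σ ∉ S → W ⊆ U σ})
    fun n => ⟨fun W hW => hW.1, Set.eq_univ_of_forall fun x => by
      obtain ⟨W, hW, hxW, hS⟩ := exists_isOpen_subset_of_tree hopen hcons hmono hcov (n + 1) x
      exact ⟨W, ⟨hW, hS⟩, hxW⟩⟩
  have hS : ∀ n, ∃ S : Set (List ℕ), S.Finite ∧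
      ∀ W ∈ ℱ n, ∀ σ, σ.length = n + 1 → σ ∉ S → W ⊆ U σ := by
    intro n
    choose! S hSfin hSsub using fun W (hW : W ∈ ℱ n) => ((hℱ n).2 hW).2
    exact ⟨⋃ W ∈ ℱ n, S W, (hℱ n).1.biUnion hSfin, fun W hW σ hlen hσ =>
      hSsub W hW σ hlen fun h => hσ (Set.mem_biUnion hW h)⟩
  choose S hSfin hSsub using hS
  have hnext : ∀ n σ, ∃ m : ℕ, m :: σ ∉ S n := fun n σ => by
    have hinj : Function.Injective fun m : ℕ => m :: σ := fun a b h => (List.cons.inj h).1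
    exact ((hSfin n).preimage hinj.injOn).exists_notMem
  choose next hnext using hnext
  let p : ℕ → List ℕ := fun n => Nat.rec [] (fun k σ => next k σ :: σ) n
  have hp : ∀ n, p (n + 1) = next n (p n) :: p n := fun _ => rfl
  have hlen : ∀ n, (p n).length = n := by
    intro n
    induction n with
    | zero => rfl
    | succ n ih => rw [hp, List.length_cons, ih]
  refine ⟨p, fun n => next n (p n), rfl, hp, fun x => ?_⟩
  obtain ⟨W, hW, hxW⟩ : x ∈ ⋃₀ ⋃ n, ℱ n := hℱcov ▸ Set.mem_univ x
  obtain ⟨n, hn⟩ := Set.mem_iUnion.1 hW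
  exact ⟨n + 1, hSsub n W hn (p (n + 1)) (hlen (n + 1)) (hnext n (p n)) hxW⟩

/-- The history of the moves `E hist m` selected by the indices in a list, most recent first. -/
def selectedHistory {α : Type*} (E : List α → ℕ → α) : List ℕ → List α
  | [] => []
  | m :: σ => selectedHistory E σ ++ [E (selectedHistory E σ) m]

/-- The set covered by the moves `E hist m` selected by the indices in a list, most recent
first. -/
def selectedUnion {X : Type*} (E : List (Set (Set X)) → ℕ → Set (Set X)) : List ℕ → Set X
  | [] => ∅
  | m :: σ => selectedUnion E σ ∪ ⋃₀ E (selectedHistory E σ) m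

/-- **Hurewicz's Theorem.** If `X` satisfies Menger's property `S_fin(O,O)`, then Alice has no
winning strategy in the Menger game `G_fin(O,O)` on `X`. -/
theorem hurewicz_menger_game {X : Type*} [TopologicalSpace X] (hX : MengerSpace X) :
    ¬ ∃ strat : List (Set (Set X)) → Set (Set X),
      (∀ hist, IsOpenCover (strat hist)) ∧ MengerWinningStrategy strat := by
  rintro ⟨strat, hcover, hwin⟩
  choose E hEmono hE hEcov using fun hist => hX.exists_monotone_finite (hcover hist)
  have hopen : ∀ σ, IsOpen (selectedUnion E σ) := by
    intro σ
    induction σ with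
    | nil => exact isOpen_empty
    | cons m σ ih =>
      exact ih.union (isOpen_sUnion fun V hV => (hcover _).1 V ((hE _ m).2 hV))
  obtain ⟨p, m, hp0, hp, hpcov⟩ := hX.exists_branch_of_tree hopen
    (fun _ _ => Set.subset_union_left)
    (fun σ _ _ hab => Set.union_subset_union_right _ (Set.sUnion_subset_sUnion (hEmono _ hab)))
    (fun σ x => (hEcov (selectedHistory E σ) x).imp fun _ h => Or.inr h)
  let F : ℕ → Set (Set X) := fun n => E (selectedHistory E (p n)) (m n)
  have hist_eq : ∀ n, (List.ofFn fun i : Fin n => F i) = selectedHistory E (p n) := by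
    intro n
    induction n with
    | zero => rw [hp0]; rfl
    | succ n ih =>
      rw [List.ofFn_succ', List.concat_eq_append, hp]
      exact congrArg (· ++ [F n]) ih
  have hsub : ∀ n, selectedUnion E (p n) ⊆ ⋃₀ ⋃ n, F n := by
    intro n
    induction n with
    | zero => rw [hp0]; exact Set.empty_subset _
    | succ n ih =>
      rw [hp]
      exact Set.union_subset ih (Set.sUnion_subset_sUnion (Set.subset_iUnion F n))
  refine hwin F (fun n => ?_) (Set.eq_univ_of_forall fun x => ?_)
  · rw [hist_eq]
    exact hE _ _
  · obtain ⟨n, hn⟩ := hpcov x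
    exact hsub n hn
end

section
/- Tail-cover lemma: Let X be a topological space and let (U_σ) be open subsets of X indexed by nonempty finite sequences σ of natural numbers such that: (i) for every finite sequence σ (possibly empty), the family {U_{σ⌢k} : k ∈ ℕ} is an open cover of X; (ii) these covers are increasing, i.e., U_{σ⌢k} ⊆ U_{σ⌢(k+1)} for all σ and k; (iii) for every nonempty σ, U_σ = U_{σ⌢1}. Then for every n ≥ 1, the family V_n := {U_σ : σ ∈ ℕ^n} is a tail cover of X. -/
/-- A countable cover `𝒰` of `X` is a *tail cover* if the family of intersections of cofinite
subfamilies of `𝒰` is an open cover of `X`: every intersection of a cofinite subfamily of `𝒰`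
is open, and every point lies in some such intersection. -/
def IsTailCover {X : Type*} [TopologicalSpace X] (𝒰 : Set (Set X)) : Prop :=
  𝒰.Countable ∧ ⋃₀ 𝒰 = Set.univ ∧
  (∀ 𝒱 ⊆ 𝒰, (𝒰 \ 𝒱).Finite → IsOpen (⋂₀ 𝒱)) ∧
  ∀ x : X, ∃ 𝒱 ⊆ 𝒰, (𝒰 \ 𝒱).Finite ∧ x ∈ ⋂₀ 𝒱

/-- Along a monotone cover of `X`, only the set `X` itself can be taken infinitely often from a
given finite collection of sets. -/
theorem eventually_eq_univ_of_mem_finite {X : Type*} {f : ℕ → Set X} (hf : Monotone f)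
    (hcover : ⋃ k, f k = Set.univ) {F : Set (Set X)} (hF : F.Finite) :
    ∀ᶠ k in Filter.atTop, f k ∈ F → f k = Set.univ := by
  have h : ∀ᶠ k in Filter.atTop, ∀ V ∈ F, f k = V → f k = Set.univ := by
    refine (Filter.eventually_all_finite hF).2 fun V _ => ?_
    by_cases hV : ∃ᶠ k in Filter.atTop, f k = V
    · have hV' : V = Set.univ := by
        refine Set.univ_subset_iff.1 (hcover ▸ Set.iUnion_subset fun k => ?_)
        obtain ⟨j, hj, rfl⟩ := Filter.frequently_atTop.1 hV k
        exact hf hj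
      exact Filter.Eventually.of_forall fun k hk => hk.trans hV'
    · exact (Filter.not_frequently.1 hV).mono fun k hk h => absurd h hk
  exact h.mono fun k hk hkF => hk _ hkF rfl

section

variable {X : Type*} {U : List ℕ → Set X}

theorem subset_append_of_first
    (hmono : ∀ (σ : List ℕ) (k : ℕ), U (σ ++ [k]) ⊆ U (σ ++ [k + 1]))
    (hfirst : ∀ (σ : List ℕ) (k : ℕ), U (σ ++ [k]) = U (σ ++ [k] ++ [0]))
    (σ : List ℕ) (k : ℕ) (τ : List ℕ) : U (σ ++ [k]) ⊆ U (σ ++ [k] ++ τ) := by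
  induction τ generalizing σ k with
  | nil => simp
  | cons a τ ih =>
    calc U (σ ++ [k]) = U (σ ++ [k] ++ [0]) := hfirst σ k
      _ ⊆ U (σ ++ [k] ++ [a]) :=
        monotone_nat_of_le_succ (f := fun j => U (σ ++ [k] ++ [j])) (hmono _) (Nat.zero_le a)
      _ ⊆ U (σ ++ [k] ++ [a] ++ τ) := ih _ _
      _ = U (σ ++ [k] ++ a :: τ) := by simp

theorem append_replicate_zero_of_first
    (hfirst : ∀ (σ : List ℕ) (k : ℕ), U (σ ++ [k]) = U (σ ++ [k] ++ [0]))
    (σ : List ℕ) (k n : ℕ) : U (σ ++ [k] ++ List.replicate n 0) = U (σ ++ [k]) := by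
  induction n generalizing σ k with
  | zero => simp
  | succ n ih =>
    rw [hfirst σ k, ← ih, List.replicate_succ]
    simp

/-- The intersection of the sets `U (σ ⌢ τ)`, `τ ∈ ℕ^n`, that do not belong to `F`. -/
def interOutside (U : List ℕ → Set X) (F : Set (Set X)) (n : ℕ) (σ : List ℕ) : Set X :=
  {x | ∀ τ : List ℕ, τ.length = n → U (σ ++ τ) ∉ F → x ∈ U (σ ++ τ)}

theorem interOutside_zero (F : Set (Set X)) (σ : List ℕ) :
    interOutside U F 0 σ = {x | U σ ∉ F → x ∈ U σ} := by
  ext x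
  simp [interOutside]

theorem interOutside_succ (F : Set (Set X)) (n : ℕ) (σ : List ℕ) :
    interOutside U F (n + 1) σ = ⋂ k, interOutside U F n (σ ++ [k]) := by
  ext x
  simp only [interOutside, Set.mem_ofPred_eq, Set.mem_iInter]
  constructor
  · intro h k τ hτ
    simpa using h (k :: τ) (by simp [hτ])
  · rintro h (_ | ⟨k, τ⟩) hτ
    · simp at hτ
    · simpa using h k τ (by simpa using hτ)

theorem interOutside_anti {F G : Set (Set X)} (h : F ⊆ G) (n : ℕ) (σ : List ℕ) :
    interOutside U F n σ ⊆ interOutside U G n σ :=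
  fun _ hx τ hτ hG => hx τ hτ fun hF => hG (h hF)

theorem subset_interOutside
    (hmono : ∀ (σ : List ℕ) (k : ℕ), U (σ ++ [k]) ⊆ U (σ ++ [k + 1]))
    (hfirst : ∀ (σ : List ℕ) (k : ℕ), U (σ ++ [k]) = U (σ ++ [k] ++ [0]))
    (F : Set (Set X)) (n : ℕ) (σ : List ℕ) (k : ℕ) :
    U (σ ++ [k]) ⊆ interOutside U F n (σ ++ [k]) :=
  fun _ hx τ _ _ => subset_append_of_first hmono hfirst σ k τ hx

theorem interOutside_eq
    (hmono : ∀ (σ : List ℕ) (k : ℕ), U (σ ++ [k]) ⊆ U (σ ++ [k + 1]))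
    (hfirst : ∀ (σ : List ℕ) (k : ℕ), U (σ ++ [k]) = U (σ ++ [k] ++ [0]))
    {F : Set (Set X)} (n : ℕ) {σ : List ℕ} {k : ℕ}
    (h : U (σ ++ [k]) ∈ F → U (σ ++ [k]) = Set.univ) :
    interOutside U F n (σ ++ [k]) = U (σ ++ [k]) := by
  refine (subset_interOutside hmono hfirst F n σ k).antisymm' fun x hx => ?_
  by_cases hF : U (σ ++ [k]) ∈ F
  · simp [h hF]
  · have hrep := append_replicate_zero_of_first hfirst σ k n
    exact hrep ▸ hx (List.replicate n 0) (by simp) (hrep.symm ▸ hF)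

theorem isOpen_interOutside [TopologicalSpace X]
    (hopen : ∀ (σ : List ℕ) (k : ℕ), IsOpen (U (σ ++ [k])))
    (hcover : ∀ σ : List ℕ, ⋃ k : ℕ, U (σ ++ [k]) = Set.univ)
    (hmono : ∀ (σ : List ℕ) (k : ℕ), U (σ ++ [k]) ⊆ U (σ ++ [k + 1]))
    (hfirst : ∀ (σ : List ℕ) (k : ℕ), U (σ ++ [k]) = U (σ ++ [k] ++ [0]))
    {F : Set (Set X)} (hF : F.Finite) (n : ℕ) (σ : List ℕ) (hσ : n = 0 → IsOpen (U σ)) :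
    IsOpen (interOutside U F n σ) := by
  induction n generalizing σ with
  | zero =>
    rw [interOutside_zero]
    by_cases h : U σ ∈ F
    · simp [h]
    · simpa [h] using hσ rfl
  | succ n ih =>
    have hm : Monotone fun k => U (σ ++ [k]) := monotone_nat_of_le_succ (hmono σ)
    obtain ⟨K, hK⟩ :=
      Filter.eventually_atTop.1 (eventually_eq_univ_of_mem_finite hm (hcover σ) hF)
    have heq : interOutside U F (n + 1) σ =
        (⋂ k ∈ Set.Iio K, interOutside U F n (σ ++ [k])) ∩ U (σ ++ [K]) := by
      rw [interOutside_succ]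
      ext x
      simp only [Set.mem_iInter, Set.mem_inter_iff, Set.mem_Iio]
      refine ⟨fun h => ⟨fun k _ => h k, ?_⟩, fun h k => ?_⟩
      · rw [← interOutside_eq hmono hfirst n (hK K le_rfl)]
        exact h K
      · rcases lt_or_ge k K with hk | hk
        · exact h.1 k hk
        · exact subset_interOutside hmono hfirst F n σ k (hm hk h.2)
    rw [heq]
    exact ((Set.finite_Iio K).isOpen_biInter fun k _ => ih _ fun _ => hopen σ k).inter
      (hopen σ K)

theorem exists_finite_mem_interOutside
    (hcover : ∀ σ : List ℕ, ⋃ k : ℕ, U (σ ++ [k]) = Set.univ)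
    (hmono : ∀ (σ : List ℕ) (k : ℕ), U (σ ++ [k]) ⊆ U (σ ++ [k + 1]))
    (hfirst : ∀ (σ : List ℕ) (k : ℕ), U (σ ++ [k]) = U (σ ++ [k] ++ [0]))
    (x : X) (n : ℕ) (σ : List ℕ) :
    ∃ F : Set (Set X), F.Finite ∧ x ∈ interOutside U F n σ := by
  induction n generalizing σ with
  | zero => exact ⟨{U σ}, Set.finite_singleton _, by simp [interOutside_zero]⟩
  | succ n ih =>
    choose F hF hx using fun k => ih (σ ++ [k])
    obtain ⟨K, hK⟩ := Set.mem_iUnion.1 (hcover σ ▸ Set.mem_univ x)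
    have hm : Monotone fun k => U (σ ++ [k]) := monotone_nat_of_le_succ (hmono σ)
    refine ⟨⋃ k ∈ Set.Iio K, F k, (Set.finite_Iio K).biUnion fun k _ => hF k, ?_⟩
    rw [interOutside_succ]
    refine Set.mem_iInter.2 fun k => ?_
    rcases lt_or_ge k K with hk | hk
    · exact interOutside_anti (Set.subset_biUnion_of_mem (u := F) (Set.mem_Iio.2 hk)) n _ (hx k)
    · exact subset_interOutside hmono hfirst _ n σ k (hm hk hK)

end

/-- **Tail-cover lemma.** Let `U σ` be open sets indexed by nonempty finite sequences of
naturals such that for every (possibly empty) `σ` the family `{U (σ ⌢ k) : k ∈ ℕ}` is an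
increasing open cover of `X`, and `U σ` equals the first member `U (σ ⌢ 0)` of the next cover.
Then for every `n ≥ 1` the family `{U σ : σ ∈ ℕ^n}` is a tail cover of `X`. -/
theorem tail_cover_lemma {X : Type*} [TopologicalSpace X]
    (U : List ℕ → Set X)
    (hopen : ∀ (σ : List ℕ) (k : ℕ), IsOpen (U (σ ++ [k])))
    (hcover : ∀ σ : List ℕ, ⋃ k : ℕ, U (σ ++ [k]) = Set.univ)
    (hmono : ∀ (σ : List ℕ) (k : ℕ), U (σ ++ [k]) ⊆ U (σ ++ [k + 1]))
    (hfirst : ∀ (σ : List ℕ) (k : ℕ), U (σ ++ [k]) = U (σ ++ [k] ++ [0]))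
    (n : ℕ) (hn : 1 ≤ n) :
    IsTailCover {V : Set X | ∃ σ : List ℕ, σ.length = n ∧ V = U σ} := by
  refine ⟨?_, ?_, fun 𝒱 h𝒱 hfin => ?_, fun x => ?_⟩
  · refine (Set.countable_range U).mono ?_
    rintro _ ⟨σ, -, rfl⟩
    exact ⟨σ, rfl⟩
  · refine Set.eq_univ_of_forall fun x => ?_
    obtain ⟨k, hk⟩ := Set.mem_iUnion.1 (hcover (List.replicate (n - 1) 0) ▸ Set.mem_univ x)
    exact ⟨_, ⟨_, by simp; omega, rfl⟩, hk⟩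
  · convert isOpen_interOutside hopen hcover hmono hfirst hfin n [] (by omega) using 1
    ext x
    refine ⟨fun hx τ hτ hF => hx _ ?_, fun hx V hV => ?_⟩
    · by_contra h
      exact hF ⟨⟨τ, hτ, rfl⟩, h⟩
    · obtain ⟨τ, hτ, rfl⟩ := h𝒱 hV
      exact hx τ hτ fun h => h.2 hV
  · obtain ⟨F, hF, hx⟩ := exists_finite_mem_interOutside hcover hmono hfirst x n []
    refine ⟨_ \ F, Set.sdiff_subset, hF.subset ?_, ?_⟩
    · rw [sdiff_sdiff_right_self]
      exact Set.inter_subset_right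
    · rintro _ ⟨⟨τ, hτ, rfl⟩, hτF⟩
      exact hx τ hτ hτF
end

section
/- Pawlikowski's selection lemma: Let X be a topological space satisfying Rothberger's property S_1(O,O). Let F_1, F_2, … be nonempty finite families of open subsets of X such that for each point x ∈ X we have x ∈ ⋃F_n for infinitely many n. Then there are elements U_1 ∈ F_1, U_2 ∈ F_2, … such that the family {U_n : n ∈ ℕ} covers the space X. -/
/-- Rothberger's property `S_1(O,O)`: for every sequence of open covers one can choose one
member from each cover such that the chosen sets cover the space. -/
def RothbergerSpace (X : Type*) [TopologicalSpace X] : Prop :=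
  ∀ 𝒰 : ℕ → Set (Set X), (∀ n, IsOpenCover (𝒰 n)) →
    ∃ U : ℕ → Set X, (∀ n, U n ∈ 𝒰 n) ∧ ⋃ n, U n = Set.univ

/-- Finite sets `A 0, A 1, …` with `n < #(A n)` have distinct representatives. -/
theorem exists_injective_mem_of_lt_card {α : Type*} (A : ℕ → Finset α)
    (hA : ∀ n, n < (A n).card) : ∃ g : ℕ → α, Function.Injective g ∧ ∀ n, g n ∈ A n := by
  classical
  refine (Finset.all_card_le_biUnion_card_iff_exists_injective A).1 fun s => ?_
  rcases s.eq_empty_or_nonempty with rfl | hs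
  · simp
  · have hsub : s ⊆ Finset.range (s.max' hs + 1) := fun i hi =>
      Finset.mem_range.2 (Nat.lt_succ_of_le (s.le_max' i hi))
    calc s.card ≤ s.max' hs + 1 := by simpa using Finset.card_le_card hsub
      _ ≤ (A (s.max' hs)).card := hA _
      _ ≤ (s.biUnion A).card :=
        Finset.card_le_card (Finset.subset_biUnion_of_mem A (s.max'_mem hs))

/-- If every point lies in `⋃₀ F n` for infinitely many `n`, then the intersections of members
of `k` of the families `F n` form an open cover. -/
theorem isOpenCover_setOf_biInter {X : Type*} [TopologicalSpace X] (F : ℕ → Set (Set X))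
    (hne : ∀ n, (F n).Nonempty) (hopen : ∀ n, ∀ V ∈ F n, IsOpen V)
    (hinf : ∀ x : X, {n : ℕ | x ∈ ⋃₀ F n}.Infinite) (k : ℕ) :
    IsOpenCover {W : Set X | ∃ (A : Finset ℕ) (V : ℕ → Set X),
      A.card = k ∧ (∀ n, V n ∈ F n) ∧ ⋂ n ∈ A, V n = W} := by
  refine ⟨?_, Set.eq_univ_of_forall fun x => ?_⟩
  · rintro _ ⟨A, V, -, hV, rfl⟩
    exact isOpen_biInter_finset fun n _ => hopen n _ (hV n)
  · obtain ⟨A, hA, hcard⟩ := (hinf x).exists_subset_card_eq k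
    have hex : ∀ n, ∃ V ∈ F n, x ∈ ⋃₀ F n → x ∈ V := by
      intro n
      by_cases hx : x ∈ ⋃₀ F n
      · obtain ⟨V, hV, hxV⟩ := hx
        exact ⟨V, hV, fun _ => hxV⟩
      · obtain ⟨V, hV⟩ := hne n
        exact ⟨V, hV, fun h => absurd h hx⟩
    choose V hV hxV using hex
    exact ⟨_, ⟨A, V, hcard, hV, rfl⟩, Set.mem_iInter₂.2 fun n hn => hxV n (hA hn)⟩

/-- **Pawlikowski's selection lemma.** Let `X` satisfy `S_1(O,O)` and let `F 0, F 1, …` be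
nonempty finite families of open sets such that every point of `X` lies in `⋃ F n` for
infinitely many `n`. Then one can choose `U n ∈ F n` so that `{U n : n ∈ ℕ}` covers `X`. -/
theorem pawlikowski_selection {X : Type*} [TopologicalSpace X] (hX : RothbergerSpace X)
    (F : ℕ → Set (Set X))
    (hfin : ∀ n, (F n).Finite) (hne : ∀ n, (F n).Nonempty)
    (hopen : ∀ n, ∀ V ∈ F n, IsOpen V)
    (hinf : ∀ x : X, {n : ℕ | x ∈ ⋃₀ F n}.Infinite) :
    ∃ U : ℕ → Set X, (∀ n, U n ∈ F n) ∧ ⋃ n, U n = Set.univ := by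
  obtain ⟨W, hW, hcover⟩ := hX _ fun m => isOpenCover_setOf_biInter F hne hopen hinf (m + 1)
  choose A V hcard hV hAV using hW
  obtain ⟨g, hg, hgA⟩ := exists_injective_mem_of_lt_card A fun m => by rw [hcard]; omega
  refine ⟨fun n => V (Function.invFun g n) n, fun n => hV _ n,
    Set.eq_univ_of_forall fun x => ?_⟩
  obtain ⟨m, hm⟩ := Set.mem_iUnion.1 (hcover.symm ▸ Set.mem_univ x)
  rw [← hAV m] at hm
  refine Set.mem_iUnion.2 ⟨g m, ?_⟩
  simpa only [Function.leftInverse_invFun hg m] using Set.mem_iInter₂.1 hm (g m) (hgA m)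
end

section
/- Pawlikowski's Theorem: Let X be a topological space satisfying Rothberger's property S_1(O,O). Then Alice does not have a winning strategy in the Rothberger game G_1(O,O) played on X. -/
/-- A strategy for Alice in the Rothberger game `G_1(O,O)` (a function from finite histories
of Bob's chosen sets to covers) is winning if for every play of Bob consisting of legal moves
(members of Alice's covers), Bob's selections fail to cover the space. -/
def RothbergerWinningStrategy {X : Type*} [TopologicalSpace X]
    (strat : List (Set X) → Set (Set X)) : Prop :=
  ∀ U : ℕ → Set X,
    (∀ n, U n ∈ strat (List.ofFn fun i : Fin n => U i)) →
    ⋃ n, U n ≠ Set.univ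

section Selection

open Set

variable {X : Type*} [TopologicalSpace X]

/-- Rothberger's property for indexed covers. -/
lemma RothbergerSpace.exists_index {ι : Type*} (hX : RothbergerSpace X) (V : ℕ → ι → Set X)
    (hV : ∀ n i, IsOpen (V n i)) (hc : ∀ n x, ∃ i, x ∈ V n i) :
    ∃ f : ℕ → ι, ∀ x, ∃ n, x ∈ V n (f n) := by
  obtain ⟨U, hU, hU'⟩ := hX (fun n => range (V n)) fun n => by
    refine ⟨?_, ?_⟩
    · rintro _ ⟨i, rfl⟩
      exact hV n i
    · rw [sUnion_range, iUnion_eq_univ_iff]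
      exact hc n
  choose f hf using hU
  refine ⟨f, fun x => ?_⟩
  obtain ⟨n, hn⟩ := iUnion_eq_univ_iff.1 hU' x
  exact ⟨n, by rwa [hf n]⟩

/-- A sequence of finite families such that every point is covered by infinitely many of them
admits a covering selection. -/
lemma RothbergerSpace.exists_selection (hX : RothbergerSpace X) (F : ℕ → ℕ → Set X) (m : ℕ → ℕ)
    (hF : ∀ k i, IsOpen (F k i)) (hc : ∀ x N, ∃ k ≥ N, ∃ i ≤ m k, x ∈ F k i) :
    ∃ f : ℕ → ℕ, (∀ k, f k ≤ m k) ∧ ∀ x, ∃ k, x ∈ F k (f k) := by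
  classical
  have key : ∃ p : ℕ → Finset ℕ × {g : ℕ → ℕ // ∀ k, g k ≤ m k},
      ∀ x, ∃ n, x ∈ {y | (p n).1.card = n + 1 ∧ ∀ k ∈ (p n).1, y ∈ F k ((p n).2.1 k)} := by
    refine hX.exists_index (ι := Finset ℕ × {g : ℕ → ℕ // ∀ k, g k ≤ m k})
      (fun n p => {y | p.1.card = n + 1 ∧ ∀ k ∈ p.1, y ∈ F k (p.2.1 k)}) ?_ ?_
    · intro n p
      refine isOpen_const.and ?_
      have : {y | ∀ k ∈ p.1, y ∈ F k (p.2.1 k)} = ⋂ k ∈ p.1, F k (p.2.1 k) := by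
        ext y; simp
      rw [this]
      exact isOpen_biInter_finset fun k _ => hF _ _
    · intro n x
      have hinf : {k | ∃ i ≤ m k, x ∈ F k i}.Infinite :=
        Set.infinite_of_forall_exists_gt fun N => by
          obtain ⟨k, hk, h⟩ := hc x (N + 1)
          exact ⟨k, h, hk⟩
      obtain ⟨I, hI, hcard⟩ := hinf.exists_subset_card_eq (n + 1)
      have hg : ∀ k, ∃ i ≤ m k, k ∈ I → x ∈ F k i := fun k => by
        by_cases hk : k ∈ I
        · obtain ⟨i, hi, hx⟩ := hI hk
          exact ⟨i, hi, fun _ => hx⟩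
        · exact ⟨0, Nat.zero_le _, fun h => absurd h hk⟩
      choose g hg hg' using hg
      exact ⟨(I, ⟨g, hg⟩), hcard, fun k hk => hg' k hk⟩
  obtain ⟨p, hp⟩ := key
  have hall : ∃ e : {n // (p n).1.card = n + 1} → ℕ,
      Function.Injective e ∧ ∀ n, e n ∈ (p n.1).1 := by
    refine (Finset.all_card_le_biUnion_card_iff_exists_injective
      fun n : {n // (p n).1.card = n + 1} => (p n).1).1 fun s => ?_
    rcases s.eq_empty_or_nonempty with rfl | hs
    · simp
    obtain ⟨n, hn, hmax⟩ := s.exists_max_image (fun n => n.1) hs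
    calc s.card = (s.map (Function.Embedding.subtype _)).card := (Finset.card_map _).symm
      _ ≤ (Finset.range (n.1 + 1)).card := by
        refine Finset.card_le_card fun i hi => ?_
        obtain ⟨a, ha, rfl⟩ := Finset.mem_map.1 hi
        exact Finset.mem_range.2 (Nat.lt_succ_of_le (hmax a ha))
      _ = (p n).1.card := by rw [Finset.card_range, n.2]
      _ ≤ _ := Finset.card_le_card
        (Finset.subset_biUnion_of_mem (fun n : {n // (p n).1.card = n + 1} => (p n).1) hn)
  obtain ⟨e, he, he'⟩ := hall
  refine ⟨fun k => if h : ∃ n, e n = k then (p h.choose).2.1 k else 0, fun k => ?_, fun x => ?_⟩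
  · dsimp only
    split_ifs with h
    · exact (p h.choose).2.2 k
    · exact Nat.zero_le _
  · obtain ⟨n, hn, hx⟩ := hp x
    refine ⟨e ⟨n, hn⟩, ?_⟩
    have h : ∃ n', e n' = e ⟨n, hn⟩ := ⟨_, rfl⟩
    have h' : h.choose = ⟨n, hn⟩ := he h.choose_spec
    dsimp only
    rw [dif_pos h, h']
    exact hx _ (he' ⟨n, hn⟩)

end Selection

section MengerGame

variable {X S : Type*}

/-- The set of points that are caught, within the first `n + 1` moves from the state `s`, by every
play containing a move that is at least `c`. -/
def caughtSet (next : S → ℕ → S) (W : S → ℕ → Set X) : ℕ → S → ℕ → Set X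
  | 0, s, c => W s c
  | n + 1, s, c => W s c ∩ ⋂ m ∈ Finset.range c, (W s m ∪ caughtSet next W n (next s m) c)

variable {next : S → ℕ → S} {W : S → ℕ → Set X}

lemma mem_caughtSet_succ {n : ℕ} {s : S} {c : ℕ} {x : X} :
    x ∈ caughtSet next W (n + 1) s c ↔
      x ∈ W s c ∧ ∀ m < c, x ∈ W s m ∨ x ∈ caughtSet next W n (next s m) c := by
  simp [caughtSet]

lemma isOpen_caughtSet [TopologicalSpace X] (hW : ∀ s m, IsOpen (W s m)) (n : ℕ) (s : S) (c : ℕ) :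
    IsOpen (caughtSet next W n s c) := by
  induction n generalizing s with
  | zero => exact hW s c
  | succ n ih =>
    exact (hW s c).inter (isOpen_biInter_finset fun m _ => (hW s m).union (ih _))

lemma caughtSet_mono (hW : ∀ s, Monotone (W s)) (n : ℕ) (s : S) :
    Monotone (caughtSet next W n s) := by
  induction n generalizing s with
  | zero => exact hW s
  | succ n ih =>
    intro c d hcd x hx
    rw [mem_caughtSet_succ] at hx ⊢
    refine ⟨hW s hcd hx.1, fun m _ => ?_⟩
    rcases lt_or_ge m c with h | h
    · exact (hx.2 m h).imp_right fun h' => ih _ hcd h'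
    · exact Or.inl (hW s h hx.1)

lemma exists_mem_caughtSet (hW : ∀ s, Monotone (W s)) (hc : ∀ s x, ∃ m, x ∈ W s m)
    (n : ℕ) (s : S) (x : X) : ∃ c, x ∈ caughtSet next W n s c := by
  induction n generalizing s with
  | zero => exact hc s x
  | succ n ih =>
    obtain ⟨a, ha⟩ := hc s x
    choose b hb using fun m => ih (next s m)
    refine ⟨max a ((Finset.range a).sup b), mem_caughtSet_succ.2
      ⟨hW s (le_max_left _ _) ha, fun m _ => ?_⟩⟩
    rcases lt_or_ge m a with h | h
    · exact Or.inr (caughtSet_mono hW _ _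
        (le_max_of_le_right (Finset.le_sup (Finset.mem_range.2 h))) (hb m))
    · exact Or.inl (hW s h ha)

lemma exists_mem_of_mem_caughtSet (hW : ∀ s, Monotone (W s)) {s : ℕ → S} {m : ℕ → ℕ}
    (hs : ∀ k, s (k + 1) = next (s k) (m k)) {x : X} {n a c : ℕ}
    (hx : x ∈ caughtSet next W n (s a) c) (hcm : c ≤ m (a + n)) : ∃ k, x ∈ W (s k) (m k) := by
  induction n generalizing a with
  | zero => exact ⟨a, hW _ hcm hx⟩
  | succ n ih =>
    rw [mem_caughtSet_succ] at hx
    rcases lt_or_ge (m a) c with h | h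
    · rcases hx.2 _ h with h' | h'
      · exact ⟨a, h'⟩
      · rw [← hs] at h'
        exact ih h' (by rwa [Nat.add_right_comm])
    · exact ⟨a, hW _ h hx.1⟩

/-- In the Menger game with increasing countable covers, some play covers each point infinitely
often. -/
lemma RothbergerSpace.exists_infinitely_often [TopologicalSpace X] (hX : RothbergerSpace X)
    (next : S → ℕ → S) (W : S → ℕ → Set X) (hWo : ∀ s m, IsOpen (W s m))
    (hW : ∀ s, Monotone (W s)) (hc : ∀ s x, ∃ m, x ∈ W s m) (s₀ : S) :
    ∃ (s : ℕ → S) (m : ℕ → ℕ), s 0 = s₀ ∧ (∀ k, s (k + 1) = next (s k) (m k)) ∧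
      ∀ x N, ∃ k ≥ N, x ∈ W (s k) (m k) := by
  let W' : ℕ → S → ℕ → Set X := fun j s m => {x | j ≤ m ∧ x ∈ W s m}
  have hWo' : ∀ j s m, IsOpen (W' j s m) := fun j s m => isOpen_const.and (hWo s m)
  have hW' : ∀ j s, Monotone (W' j s) := fun j s a b hab x hx =>
    ⟨hx.1.trans hab, hW s hab hx.2⟩
  have hc' : ∀ j s x, ∃ m, x ∈ W' j s m := fun j s x => by
    obtain ⟨m, hm⟩ := hc s x
    exact ⟨max j m, le_max_left _ _, hW s (le_max_right _ _) hm⟩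
  have hsel : ∀ j, ∃ h : ℕ → ℕ, ∀ x, ∃ i, x ∈ caughtSet next (W' j) (Nat.pair j i) s₀ (h i) :=
    fun j => hX.exists_index (fun i c => caughtSet next (W' j) (Nat.pair j i) s₀ c)
      (fun i c => isOpen_caughtSet (hWo' j) _ _ _)
      (fun i x => exists_mem_caughtSet (hW' j) (hc' j) _ _ x)
  choose h hh using hsel
  let m : ℕ → ℕ := fun n => h n.unpair.1 n.unpair.2
  let s : ℕ → S := fun k => Nat.rec s₀ (fun k t => next t (m k)) k
  refine ⟨s, m, rfl, fun _ => rfl, fun x N => ?_⟩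
  obtain ⟨i, hi⟩ := hh ((Finset.range N).sup m + 1) x
  obtain ⟨k, hk, hx⟩ := exists_mem_of_mem_caughtSet (hW' _) (s := s) (m := m) (fun _ => rfl)
    (a := 0) hi (by simp [m])
  refine ⟨k, ?_, hx⟩
  by_contra! hkN
  have : m k ≤ (Finset.range N).sup m := Finset.le_sup (Finset.mem_range.2 hkN)
  omega

end MengerGame

section RothbergerGame

open Set

variable {X : Type*}

/-- The history obtained from `t` by letting Bob play the moves with codes `τ`. -/
def playCodes (u : List (Set X) → ℕ → Set X) (t : List (Set X)) (τ : List ℕ) : List (Set X) :=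
  τ.foldl (fun t k => t ++ [u t k]) t

variable {u : List (Set X) → ℕ → Set X}

lemma playCodes_append (t : List (Set X)) (τ ρ : List ℕ) :
    playCodes u t (τ ++ ρ) = playCodes u (playCodes u t τ) ρ :=
  List.foldl_append

lemma playCodes_concat (t : List (Set X)) (τ : List ℕ) (k : ℕ) :
    playCodes u t (τ ++ [k]) = playCodes u t τ ++ [u (playCodes u t τ) k] :=
  playCodes_append t τ [k]

lemma prefix_playCodes (t : List (Set X)) (τ : List ℕ) : t <+: playCodes u t τ := by
  induction τ using List.reverseRecOn with
  | nil => exact List.prefix_rfl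
  | append_singleton τ k ih =>
    rw [playCodes_concat]
    exact ih.trans (List.prefix_append _ _)

lemma playCodes_induction {p : List (Set X) → Prop} (hp : ∀ t k, p t → p (t ++ [u t k]))
    {t : List (Set X)} (ht : p t) (τ : List ℕ) : p (playCodes u t τ) := by
  induction τ using List.reverseRecOn with
  | nil => exact ht
  | append_singleton τ k ih =>
    rw [playCodes_concat]
    exact hp _ _ ih

/-- Finitely many histories can be continued by the same codes so that all of them cover `x`. -/
lemma exists_codes_forall_mem [TopologicalSpace X] (ho : ∀ t k, IsOpen (u t k))
    (hu : ∀ t x, ∃ k, x ∈ u t k) (T : Finset (List (Set X))) (x : X) :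
    ∃ τ, ∀ t ∈ T, ∃ A ∈ playCodes u t τ, IsOpen A ∧ x ∈ A := by
  classical
  induction T using Finset.induction_on with
  | empty => exact ⟨[], by simp⟩
  | insert t T _ ih =>
    obtain ⟨τ, hτ⟩ := ih
    obtain ⟨k, hk⟩ := hu (playCodes u t τ) x
    refine ⟨τ ++ [k], fun t' ht' => ?_⟩
    rcases Finset.mem_insert.1 ht' with rfl | ht'
    · exact ⟨_, by rw [playCodes_concat]; simp, ho _ _, hk⟩
    · obtain ⟨A, hA, hx⟩ := hτ t' ht'
      exact ⟨A, by rw [playCodes_concat]; exact List.mem_append_left _ hA, hx⟩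

/-- A strictly growing chain of histories that are legal against `strat` and jointly cover the
space defeats `strat`. -/
lemma not_winning_of_chain [TopologicalSpace X] {strat : List (Set X) → Set (Set X)}
    (t : ℕ → List (Set X)) (hpre : ∀ k, t k <+: t (k + 1))
    (hlen : ∀ k, k ≤ (t k).length)
    (hlegal : ∀ k n (h : n < (t k).length), (t k)[n] ∈ strat ((t k).take n))
    (hcov : ∀ x, ∃ k, ∃ A ∈ t k, x ∈ A) : ¬ RothbergerWinningStrategy strat := by
  have hmono : ∀ {a b}, a ≤ b → t a <+: t b := fun {a b} hab => by
    induction hab with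
    | refl => exact List.prefix_rfl
    | step _ ih => exact ih.trans (hpre _)
  let U : ℕ → Set X := fun n => (t (n + 1))[n]'(hlen (n + 1))
  have hU : ∀ k n (h : n < (t k).length), (t k)[n] = U n := fun k n h => by
    rcases le_total k (n + 1) with hk | hk
    · exact (hmono hk).getElem h
    · exact ((hmono hk).getElem (hlen (n + 1))).symm
  intro hwin
  refine hwin U (fun n => ?_) (iUnion_eq_univ_iff.2 fun x => ?_)
  · have h : List.ofFn (fun i : Fin n => U i) = (t (n + 1)).take n := by
      have := hlen (n + 1)
      refine List.ext_getElem (by simp; omega) fun i _ _ => ?_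
      simp [hU]
    rw [h]
    exact hlegal (n + 1) n _
  · obtain ⟨k, A, hA, hx⟩ := hcov x
    obtain ⟨n, hn, rfl⟩ := List.getElem_of_mem hA
    exact ⟨n, by rwa [← hU k n hn]⟩

/-- If every cover offered by `strat` has a countable subcover enumerated by `u`, then `strat` is
not winning on a Rothberger space. -/
lemma not_winning_of_countable [TopologicalSpace X] (hX : RothbergerSpace X)
    {strat : List (Set X) → Set (Set X)} (u : List (Set X) → ℕ → Set X)
    (hmem : ∀ t k, u t k ∈ strat t) (ho : ∀ t k, IsOpen (u t k)) (hu : ∀ t x, ∃ k, x ∈ u t k) :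
    ¬ RothbergerWinningStrategy strat := by
  classical
  let code : ℕ → List ℕ := fun i => Denumerable.ofNat (List ℕ) i ++ [0]
  let V : Finset (List (Set X)) → ℕ → Set X := fun T i =>
    {x | ∀ t ∈ T, ∃ A ∈ playCodes u t (code i), IsOpen A ∧ x ∈ A}
  have hVo : ∀ T i, IsOpen (V T i) := fun T i => by
    have : V T i = ⋂ t ∈ T, ⋃₀ {A | A ∈ playCodes u t (code i) ∧ IsOpen A} := by
      ext x
      simp [V, and_assoc]
    rw [this]
    exact isOpen_biInter_finset fun t _ => isOpen_sUnion fun A hA => hA.2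
  have hVc : ∀ T x, ∃ i, x ∈ V T i := fun T x => by
    obtain ⟨τ, hτ⟩ := exists_codes_forall_mem ho hu T x
    refine ⟨Encodable.encode τ, fun t ht => ?_⟩
    obtain ⟨A, hA, h⟩ := hτ t ht
    refine ⟨A, ?_, h⟩
    simp only [code, Denumerable.ofNat_encode, playCodes_concat]
    exact List.mem_append_left _ hA
  obtain ⟨T, m, hT, hT', hinf⟩ := hX.exists_infinitely_often
    (fun T m => T.biUnion fun t => (Finset.range (m + 1)).image fun i => playCodes u t (code i))
    (fun T m => {x | ∃ i ≤ m, x ∈ V T i})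
    (fun T m => by
      have : {x | ∃ i ≤ m, x ∈ V T i} = ⋃ i ≤ m, V T i := by ext x; simp
      rw [this]
      exact isOpen_biUnion fun i _ => hVo T i)
    (fun T a b hab x ⟨i, hi, hx⟩ => ⟨i, hi.trans hab, hx⟩)
    (fun T x => (hVc T x).imp fun i hi => ⟨i, le_rfl, hi⟩)
    {[]}
  obtain ⟨f, hf, hfc⟩ := hX.exists_selection (fun k i => V (T k) i) m (fun k i => hVo _ _) hinf
  let t : ℕ → List (Set X) := fun k => Nat.rec [] (fun k r => playCodes u r (code (f k))) k
  have ht : ∀ k, t (k + 1) = playCodes u (t k) (code (f k)) := fun _ => rfl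
  have htT : ∀ k, t k ∈ T k := fun k => by
    induction k with
    | zero => simp [hT, t]
    | succ k ih =>
      rw [hT', ht, Finset.mem_biUnion]
      exact ⟨t k, ih, Finset.mem_image_of_mem _ (Finset.mem_range.2 (Nat.lt_succ_of_le (hf k)))⟩
  refine not_winning_of_chain t (fun k => ?_) (fun k => ?_) (fun k => ?_) (fun x => ?_)
  · exact prefix_playCodes _ _
  · induction k with
    | zero => exact Nat.zero_le _
    | succ k ih =>
      rw [ht, playCodes_concat, List.length_append, List.length_singleton]
      exact Nat.succ_le_succ (ih.trans (prefix_playCodes _ _).length_le)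
  · induction k with
    | zero => exact fun n h => absurd h (Nat.not_lt_zero n)
    | succ k ih =>
      rw [ht]
      refine playCodes_induction
        (p := fun r => ∀ n (h : n < r.length), r[n] ∈ strat (r.take n)) ?_ ih _
      intro r j hr n h
      rcases Nat.lt_or_ge n r.length with hn | hn
      · rw [List.getElem_append_left hn, List.take_append_of_le_length hn.le]
        exact hr n hn
      · have hn' : n = r.length := by
          rw [List.length_append, List.length_singleton] at h
          omega
        subst hn'
        simpa using hmem r j
  · obtain ⟨k, hk⟩ := hfc x
    obtain ⟨A, hA, -, hx⟩ := hk (t k) (htT k)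
    exact ⟨k + 1, A, hA, hx⟩

end RothbergerGame

/-- **Pawlikowski's Theorem.** If `X` satisfies Rothberger's property `S_1(O,O)`, then Alice
has no winning strategy in the Rothberger game `G_1(O,O)` on `X`. -/
theorem pawlikowski_rothberger_game {X : Type*} [TopologicalSpace X]
    (hX : RothbergerSpace X) :
    ¬ ∃ strat : List (Set X) → Set (Set X),
      (∀ hist, IsOpenCover (strat hist)) ∧ RothbergerWinningStrategy strat := by
  rintro ⟨strat, hstrat, hwin⟩
  have hcount : ∀ t, ∃ v : ℕ → Set X, (∀ k, v k ∈ strat t) ∧ ∀ x, ∃ k, x ∈ v k := fun t => by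
    obtain ⟨v, hv, hv'⟩ := hX (fun _ => strat t) fun _ => hstrat t
    exact ⟨v, hv, Set.iUnion_eq_univ_iff.1 hv'⟩
  choose u hu hcov using hcount
  exact not_winning_of_countable hX u hu (fun t k => (hstrat t).1 _ (hu t k)) hcov hwin
end

section
/- Upper continuity claim: Let X be a topological space and let (U_σ) be open subsets of X indexed by nonempty finite sequences σ of natural numbers such that: (i) for every finite sequence σ (possibly empty), the family {U_{σ⌢k} : k ∈ ℕ} is an open cover of X; (ii) U_{σ⌢k} ⊆ U_{σ⌢(k+1)} for all σ, k; (iii) whenever τ ≤ σ coordinatewise (same length), U_{σ⌢k} ⊆ U_{τ⌢k} for all k. For each x ∈ X define f_x ∈ ℕ^ℕ recursively by f_x(n) := min{m : x ∈ U_{(f_x(1),…,f_x(n−1),m)}}. Then for all natural numbers n and m, the set {x ∈ X : f_x(n) ≤ m} is open in X. -/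
/-- **Upper continuity claim.** Let `U σ` be open sets indexed by nonempty finite sequences of
naturals such that for every (possibly empty) `σ` the family `{U (σ ⌢ k) : k ∈ ℕ}` is an
increasing open cover of `X`, and the covers get finer as the index sequence gets larger.
For `x ∈ X` let `f x` be defined recursively by
`f x n = min {m : x ∈ U (f x 0, …, f x (n-1), m)}`.
Then for all `n` and `m`, the set `{x : f x n ≤ m}` is open. -/
theorem upper_continuity_claim {X : Type*} [TopologicalSpace X]
    (U : List ℕ → Set X)
    (hopen : ∀ (σ : List ℕ) (k : ℕ), IsOpen (U (σ ++ [k])))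
    (hcover : ∀ σ : List ℕ, ⋃ k : ℕ, U (σ ++ [k]) = Set.univ)
    (hmono : ∀ (σ : List ℕ) (k : ℕ), U (σ ++ [k]) ⊆ U (σ ++ [k + 1]))
    (hfiner : ∀ τ σ : List ℕ, List.Forall₂ (· ≤ ·) τ σ →
      ∀ k : ℕ, U (σ ++ [k]) ⊆ U (τ ++ [k]))
    (f : X → ℕ → ℕ)
    (hf : ∀ (x : X) (n : ℕ),
      f x n = sInf {m : ℕ | x ∈ U ((List.ofFn fun i : Fin n => f x i) ++ [m])})
    (n m : ℕ) :
    IsOpen {x : X | f x n ≤ m} := by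
  induction n using Nat.strong_induction_on generalizing m with
  | _ n ih =>
    have hmem (x : X) : x ∈ U ((List.ofFn fun i : Fin n => f x i) ++ [f x n]) := by
      have hx : x ∈ ⋃ k : ℕ, U ((List.ofFn fun i : Fin n => f x i) ++ [k]) := by
        rw [hcover]
        exact Set.mem_univ x
      obtain ⟨k, hk⟩ := Set.mem_iUnion.mp hx
      have hs : sInf {m : ℕ | x ∈ U ((List.ofFn fun i : Fin n => f x i) ++ [m])} ∈
          {m : ℕ | x ∈ U ((List.ofFn fun i : Fin n => f x i) ++ [m])} := Nat.sInf_mem ⟨k, hk⟩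
      rw [← hf x n] at hs
      exact hs
    rw [isOpen_iff_forall_mem_open]
    intro x hx
    refine ⟨(⋂ i : Fin n, {y : X | f y i ≤ f x i}) ∩
      U ((List.ofFn fun i : Fin n => f x i) ++ [f x n]), ?_, ?_, ?_, hmem x⟩
    · rintro y ⟨hy, hyU⟩
      have hle : List.Forall₂ (· ≤ ·) (List.ofFn fun i : Fin n => f y i)
          (List.ofFn fun i : Fin n => f x i) := by
        rw [List.forall₂_iff_get]
        refine ⟨by simp, fun i hi _ => ?_⟩
        simpa using Set.mem_iInter.mp hy ⟨i, by simpa using hi⟩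
      have hyn : f y n ≤ f x n := by
        rw [hf y n]
        exact Nat.sInf_le (hfiner _ _ hle _ hyU)
      exact hyn.trans hx
    · exact (isOpen_iInter_of_finite fun i : Fin n => ih i i.isLt (f x i)).inter (hopen _ _)
    · exact Set.mem_iInter.mpr fun i => le_refl (f x i)
end

section
/- Stinging lemma: Let X be a topological space and let (U_σ) be open subsets of X indexed by nonempty finite sequences σ of natural numbers such that: (i) for every finite sequence σ (possibly empty), the family {U_{σ⌢k} : k ∈ ℕ} is an open cover of X; (ii) U_{σ⌢k} ⊆ U_{σ⌢(k+1)} for all σ, k; (iii) whenever τ ≤ σ coordinatewise (same length), U_{σ⌢k} ⊆ U_{τ⌢k} for all k. For each x ∈ X define f_x ∈ ℕ^ℕ recursively by f_x(n) := min{m : x ∈ U_{(f_x(1),…,f_x(n−1),m)}}. Then for every g ∈ ℕ^ℕ and every x ∈ X, if n is the minimal natural number with f_x(n) ≤ g(n), then x ∈ U_{(g(1),…,g(n−1),g(n))}. -/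
/-- **Stinging lemma.** Let `U σ` be open sets indexed by nonempty finite sequences of
naturals such that for every (possibly empty) `σ` the family `{U (σ ⌢ k) : k ∈ ℕ}` is an
increasing open cover of `X`, and the covers get finer as the index sequence gets larger.
For `x ∈ X` let `f x` be defined recursively by
`f x n = min {m : x ∈ U (f x 0, …, f x (n-1), m)}`.
If `n` is the minimal natural number with `f x n ≤ g n`, then
`x ∈ U (g 0, …, g n)`. -/
theorem stinging_lemma {X : Type*} [TopologicalSpace X]
    (U : List ℕ → Set X)
    (hopen : ∀ (σ : List ℕ) (k : ℕ), IsOpen (U (σ ++ [k])))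
    (hcover : ∀ σ : List ℕ, ⋃ k : ℕ, U (σ ++ [k]) = Set.univ)
    (hmono : ∀ (σ : List ℕ) (k : ℕ), U (σ ++ [k]) ⊆ U (σ ++ [k + 1]))
    (hfiner : ∀ τ σ : List ℕ, List.Forall₂ (· ≤ ·) τ σ →
      ∀ k : ℕ, U (σ ++ [k]) ⊆ U (τ ++ [k]))
    (f : X → ℕ → ℕ)
    (hf : ∀ (x : X) (n : ℕ),
      f x n = sInf {m : ℕ | x ∈ U ((List.ofFn fun i : Fin n => f x i) ++ [m])})
    (g : ℕ → ℕ) (x : X) (n : ℕ)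
    (hn : f x n ≤ g n) (hmin : ∀ k < n, g k < f x k) :
    x ∈ U (List.ofFn fun i : Fin (n + 1) => g i) := by
  have hmem : x ∈ U ((List.ofFn fun i : Fin n => f x i) ++ [f x n]) := by
    have hne : {m : ℕ | x ∈ U ((List.ofFn fun i : Fin n => f x i) ++ [m])}.Nonempty :=
      Set.mem_iUnion.mp ((hcover _).symm ▸ Set.mem_univ x)
    have h := Nat.sInf_mem hne
    rwa [← hf x n] at h
  have hle : List.Forall₂ (· ≤ ·) (List.ofFn fun i : Fin n => g i)
      (List.ofFn fun i : Fin n => f x i) := by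
    rw [List.forall₂_iff_get]
    refine ⟨by simp, fun i hi _ => ?_⟩
    simpa using (hmin i (by simpa using hi)).le
  rw [List.ofFn_succ_last]
  exact hfiner _ _ hle _ (monotone_nat_of_le_succ (hmono _) hn hmem)
end

section
/- Let X be a topological space satisfying Menger's property S_fin(O,O), and let Φ : X → ℕ^ℕ be an upper continuous map, meaning that for all natural numbers n and m the set {x ∈ X : Φ(x)(n) ≤ m} is open in X. Then the image Φ[X] is not dominating: there exists g ∈ ℕ^ℕ such that for every x ∈ X, Φ(x)(n) ≤ g(n) for infinitely many n. -/
/-- For an upper continuous map on a Menger space, a single function bounds every image point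
at some index at least `k`. -/
theorem MengerSpace.exists_bound_beyond {X : Type*} [TopologicalSpace X]
    (hX : MengerSpace X) (Φ : X → ℕ → ℕ)
    (hΦ : ∀ n m : ℕ, IsOpen {x : X | Φ x n ≤ m}) (k : ℕ) :
    ∃ g : ℕ → ℕ, ∀ x : X, ∃ n, k ≤ n ∧ Φ x n ≤ g n := by
  obtain ⟨ℱ, hℱ, hcov⟩ := hX (fun n => Set.range fun m => {x : X | Φ x (n + k) ≤ m}) (by
    refine fun n => ⟨?_, ?_⟩
    · rintro _ ⟨m, rfl⟩
      exact hΦ _ _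
    · exact Set.eq_univ_of_forall fun x => ⟨_, ⟨Φ x (n + k), rfl⟩, le_refl (Φ x (n + k))⟩)
  have hbound : ∀ n, ∃ b, ∀ U ∈ ℱ n, ∀ x ∈ U, Φ x (n + k) ≤ b := by
    intro n
    have hr : ∀ U : Set X, ∃ m, U ∈ ℱ n → ∀ x ∈ U, Φ x (n + k) ≤ m := by
      intro U
      by_cases hU : U ∈ ℱ n
      · obtain ⟨m, rfl⟩ := (hℱ n).2 hU
        exact ⟨m, fun _ x hx => hx⟩
      · exact ⟨0, fun h => absurd h hU⟩
    choose r hr using hr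
    obtain ⟨b, hb⟩ := ((hℱ n).1.image r).bddAbove
    exact ⟨b, fun U hU x hx => (hr U hU x hx).trans (hb ⟨U, hU, rfl⟩)⟩
  choose b hb using hbound
  refine ⟨fun n => b (n - k), fun x => ?_⟩
  obtain ⟨U, hU, hxU⟩ : x ∈ ⋃₀ (⋃ n, ℱ n) := hcov ▸ Set.mem_univ x
  obtain ⟨n, hn⟩ := Set.mem_iUnion.1 hU
  exact ⟨n + k, Nat.le_add_left k n, by simpa using hb n U hn x hxU⟩

/-- If `X` satisfies Menger's property `S_fin(O,O)` and `Φ : X → ℕ^ℕ` is upper continuous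
(each set `{x : Φ x n ≤ m}` is open), then the image of `Φ` is not dominating: there is
`g : ℕ → ℕ` such that for every `x`, `Φ x n ≤ g n` for infinitely many `n`. -/
theorem image_not_dominating {X : Type*} [TopologicalSpace X]
    (hX : MengerSpace X) (Φ : X → ℕ → ℕ)
    (hΦ : ∀ n m : ℕ, IsOpen {x : X | Φ x n ≤ m}) :
    ∃ g : ℕ → ℕ, ∀ x : X, {n : ℕ | Φ x n ≤ g n}.Infinite := by
  choose g hg using hX.exists_bound_beyond Φ hΦ
  refine ⟨fun n => (Finset.range (n + 1)).sup fun k => g k n, fun x => ?_⟩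
  refine Set.infinite_of_forall_exists_gt fun k => ?_
  obtain ⟨n, hkn, hn⟩ := hg (k + 1) x
  exact ⟨n, hn.trans (Finset.le_sup (f := fun k => g k n)
    (Finset.mem_range.2 (Nat.lt_succ_of_le hkn))), hkn⟩
end
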